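/- Let g : ℝⁿ → ℝ be any real-valued function. Then there exists a finite family of cuts, i.e. finitely many pairs (λ_i, v_i) ∈ ℝⁿ × ℝ, such that (validity) v_i + ⟨λ_i, z⟩ ≤ g(z) for every binary vector z ∈ Bₙ and every index i, and (exactness) for every binary vector z ∈ Bₙ there is an index i with v_i + ⟨λ_i, z⟩ = g(z); equivalently, the pointwise maximum of these finitely many affine functions coincides with g on Bₙ. (A finite number of Lagrangian cuts fully describes the second-stage value function on the binary state space.) -/

import Mathlib

/-- The set of binary vectors indexed by a finite type is finite. -/
theorem finite_binary_vectors (ι : Type*) [Finite ι] :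
    {z : ι → ℝ | ∀ j, z j = 0 ∨ z j = 1}.Finite := by
  simpa [Set.pi] using Set.Finite.pi' fun _ : ι => Set.toFinite ({0, 1} : Set ℝ)

/-- For binary vectors, the linear form with coefficients `2 * x j - 1` decreases by at least one
when moving from `x` to a different point. -/
theorem one_le_sum_of_binary_ne {ι : Type*} [Fintype ι] {x z : ι → ℝ}
    (hx : ∀ j, x j = 0 ∨ x j = 1) (hz : ∀ j, z j = 0 ∨ z j = 1) (hxz : x ≠ z) :
    1 ≤ ∑ j, (2 * x j - 1) * (x j - z j) := by
  obtain ⟨k, hk⟩ := Function.ne_iff.mp hxz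
  calc (1 : ℝ) ≤ (2 * x k - 1) * (x k - z k) := by
        rcases hx k with h | h <;> rcases hz k with h' | h' <;> simp [h, h'] at hk ⊢ <;> norm_num
    _ ≤ ∑ j, (2 * x j - 1) * (x j - z j) := by
        refine Finset.single_le_sum (f := fun j => (2 * x j - 1) * (x j - z j))
          (fun j _ => ?_) (Finset.mem_univ k)
        rcases hx j with h | h <;> rcases hz j with h' | h' <;> norm_num [h, h']

/-- Every function on the binary cube has, at each binary point, an exact valid cut. -/
theorem exists_exact_cut {ι : Type*} [Fintype ι] (g : (ι → ℝ) → ℝ) {x : ι → ℝ}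
    (hx : ∀ j, x j = 0 ∨ x j = 1) :
    ∃ (lam : ι → ℝ) (v : ℝ),
      (∀ z : ι → ℝ, (∀ j, z j = 0 ∨ z j = 1) → v + ∑ j, lam j * z j ≤ g z) ∧
        v + ∑ j, lam j * x j = g x := by
  obtain ⟨M, hM⟩ := ((finite_binary_vectors ι).image fun z => g x - g z).bddAbove
  have hM' : ∀ z : ι → ℝ, (∀ j, z j = 0 ∨ z j = 1) → g x - g z ≤ M :=
    fun z hz => hM ⟨z, hz, rfl⟩
  have hM0 : 0 ≤ M := by simpa using hM' x hx
  refine ⟨fun j => M * (2 * x j - 1), g x - ∑ j, M * (2 * x j - 1) * x j, fun z hz => ?_,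
    sub_add_cancel _ _⟩
  by_cases hxz : x = z
  · simp [hxz]
  have hsum : M * ∑ j, (2 * x j - 1) * (x j - z j)
      = ∑ j, M * (2 * x j - 1) * x j - ∑ j, M * (2 * x j - 1) * z j := by
    rw [Finset.mul_sum, ← Finset.sum_sub_distrib]
    exact Finset.sum_congr rfl fun j _ => by ring
  have hle := mul_le_mul_of_nonneg_left (one_le_sum_of_binary_ne hx hz hxz) hM0
  linarith [hM' z hz]

/-- A finite family of Lagrangian cuts fully describes any function on the
binary state space: the cuts are valid everywhere on the binary cube and,
for every binary point, at least one cut is exact there. -/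
theorem finitely_many_cuts_describe_value_function
    (n : ℕ) (g : (Fin n → ℝ) → ℝ) :
    ∃ (m : ℕ) (lam : Fin m → Fin n → ℝ) (v : Fin m → ℝ),
      (∀ (i : Fin m) (z : Fin n → ℝ), (∀ j, z j = 0 ∨ z j = 1) →
        v i + ∑ j, lam i j * z j ≤ g z) ∧
      (∀ z : Fin n → ℝ, (∀ j, z j = 0 ∨ z j = 1) →
        ∃ i : Fin m, v i + ∑ j, lam i j * z j = g z) := by
  have := (finite_binary_vectors (Fin n)).to_subtype
  obtain ⟨m, ⟨e⟩⟩ := Finite.exists_equiv_fin {z : Fin n → ℝ | ∀ j, z j = 0 ∨ z j = 1}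
  choose lam v hvalid hexact using fun i : Fin m => exists_exact_cut g (e.symm i).2
  refine ⟨m, lam, v, hvalid, fun z hz => ⟨e ⟨z, hz⟩, ?_⟩⟩
  simpa only [Equiv.symm_apply_apply] using hexact (e ⟨z, hz⟩)
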